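/- arXiv:1011.3594 — 6 statements merged into one kernel-verified Lean document; each statement's English description precedes it below -/
import Mathlib

section
/- For every on-off state x ∈ {0,1}^K, the sum of the unnormalized weights π₀(w) over all valid states w whose on-off state equals x satisfies Σ_{w valid, on-off state x} π₀(w) = γ^{h(x)} · (Π_{k ∈ S(x)} T_k) · Π_{i=1}^K p_i^{x_i} q_i^{1−x_i}. Consequently, under the distribution π, the probability of the on-off state x equals (1/E) · γ^{h(x)} · (Π_{k ∈ S(x)} T_k) · Π_{i=1}^K p_i^{x_i} q_i^{1−x_i}. -/
open scoped BigOperators Classical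

/-- A CSMA/CA state: on-off vector `x`, total transmission lengths `b`,
remaining times `a` (with the convention `b k = a k = 0` for inactive links). -/
structure CState (K : ℕ) where
  x : Fin K → Bool
  b : Fin K → ℕ
  a : Fin K → ℕ

variable {K : ℕ}

/-- The set of active links forming singleton components of the induced subgraph,
i.e. active links with no active neighbour. -/
noncomputable def Sset (G : SimpleGraph (Fin K)) (x : Fin K → Bool) : Finset (Fin K) :=
  Finset.univ.filter (fun k => x k = true ∧ ∀ j, x j = true → ¬ G.Adj k j)

/-- The set of active links lying in components of size `> 1`,
i.e. active links with at least one active neighbour. -/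
noncomputable def Zset (G : SimpleGraph (Fin K)) (x : Fin K → Bool) : Finset (Fin K) :=
  Finset.univ.filter (fun k => x k = true ∧ ∃ j, x j = true ∧ G.Adj k j)

/-- The number of connected components of the induced subgraph `G(x)` of size `> 1`. -/
noncomputable def hnum (G : SimpleGraph (Fin K)) (x : Fin K → Bool) : ℕ :=
  Nat.card {c : (G.induce {k | x k = true}).ConnectedComponent // 1 < Nat.card c.supp}

/-- A valid CSMA/CA state. -/
def ValidState (G : SimpleGraph (Fin K)) (P : Fin K → ℕ → ℝ) (γ : ℕ) (w : CState K) : Prop :=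
  (∀ k, w.x k = false → w.b k = 0 ∧ w.a k = 0) ∧
  (∀ k, w.x k = true → 1 ≤ w.a k ∧ w.a k ≤ w.b k) ∧
  (∀ k ∈ Sset G w.x, 0 < P k (w.b k)) ∧
  (∀ k ∈ Zset G w.x, w.b k = γ) ∧
  (∀ k ∈ Zset G w.x, ∀ j ∈ Zset G w.x, ∀ (hk : w.x k = true) (hj : w.x j = true),
     (G.induce {i | w.x i = true}).Reachable ⟨k, hk⟩ ⟨j, hj⟩ → w.a k = w.a j)

/-- `f(b, j, x)`: equal to `1` for colliding links and `P j b` for successful links. -/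
noncomputable def fwt (G : SimpleGraph (Fin K)) (P : Fin K → ℕ → ℝ) (b : ℕ) (j : Fin K)
    (x : Fin K → Bool) : ℝ :=
  if j ∈ Zset G x then 1 else P j b

/-- The unnormalized weight `π₀(w)`. -/
noncomputable def pi0 (G : SimpleGraph (Fin K)) (P : Fin K → ℕ → ℝ) (p : Fin K → ℝ)
    (w : CState K) : ℝ :=
  (∏ i ∈ Finset.univ.filter (fun i => w.x i = false), (1 - p i)) *
    ∏ j ∈ Finset.univ.filter (fun j => w.x j = true), (p j * fwt G P (w.b j) j w.x)

/-- `A₁(w)`: active links whose remaining time exceeds `1`. -/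
noncomputable def A1 (w : CState K) : Finset (Fin K) :=
  Finset.univ.filter (fun k => w.x k = true ∧ 1 < w.a k)

/-- `Ā₁(w) = A₁(w) ∪ ∂A₁(w)`. -/
noncomputable def A1bar (G : SimpleGraph (Fin K)) (w : CState K) : Finset (Fin K) :=
  A1 w ∪ Finset.univ.filter (fun j => w.x j = false ∧ ∃ k ∈ A1 w, G.Adj j k)

/-- `A₂(w)`: the complement of `Ā₁(w)`. -/
noncomputable def A2 (G : SimpleGraph (Fin K)) (w : CState K) : Finset (Fin K) :=
  Finset.univ \ A1bar G w

/-- Admissibility of the ordered pair of states `(w, w')`. -/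
def Admissible (G : SimpleGraph (Fin K)) (γ : ℕ) (w w' : CState K) : Prop :=
  (∀ k ∈ A1bar G w, w'.x k = w.x k) ∧
  (∀ k ∈ A1bar G w, w.x k = true → w'.b k = w.b k ∧ w'.a k = w.a k - 1) ∧
  (∀ k ∈ A2 G w, w'.x k = true → w'.a k = w'.b k) ∧
  (∀ k ∈ A2 G w, k ∈ Zset G w'.x → w'.b k = γ)

/-- The transition probability `Q(w, w')` of the CSMA/CA Markov chain. -/
noncomputable def Qmat (G : SimpleGraph (Fin K)) (P : Fin K → ℕ → ℝ) (p : Fin K → ℝ) (γ : ℕ)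
    (w w' : CState K) : ℝ :=
  if Admissible G γ w w' then
    ∏ i ∈ A2 G w, (if w'.x i then p i * fwt G P (w'.b i) i w'.x else 1 - p i)
  else 0

/-- The time-reversed transition probability `Q̃(w', w)`. -/
noncomputable def Qtil (G : SimpleGraph (Fin K)) (P : Fin K → ℕ → ℝ) (p : Fin K → ℝ) (γ : ℕ)
    (w' w : CState K) : ℝ :=
  if Admissible G γ w w' then
    ∏ i ∈ A2 G w, (if w.x i then p i * fwt G P (w.b i) i w.x else 1 - p i)
  else 0

/-- The reversal map `g`. -/
def revState (w : CState K) : CState K :=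
  ⟨w.x, w.b, fun k => if w.x k then w.b k - w.a k + 1 else 0⟩

lemma S_iff (G : SimpleGraph (Fin K)) (x : Fin K → Bool) (k : Fin K) :
    k ∈ Sset G x ↔ x k = true ∧ k ∉ Zset G x := by
  simp only [Sset, Zset, Finset.mem_filter, Finset.mem_univ, true_and]
  grind

lemma big_iff (G : SimpleGraph (Fin K)) (x : Fin K → Bool) (k : Fin K) (hk : x k = true) :
    1 < Nat.card ((G.induce {k | x k = true}).connectedComponentMk ⟨k, hk⟩).supp ↔
      k ∈ Zset G x := by
  rw [Finite.one_lt_card_iff_nontrivial, Set.nontrivial_coe_sort]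
  simp only [Zset, Finset.mem_filter, Finset.mem_univ, true_and]
  constructor
  · intro h
    refine ⟨hk, ?_⟩
    obtain ⟨j, hj, hne⟩ := h.exists_ne ⟨k, hk⟩
    rw [SimpleGraph.ConnectedComponent.mem_supp_iff, SimpleGraph.ConnectedComponent.eq] at hj
    obtain ⟨w⟩ := hj.symm
    cases w with
    | nil => exact absurd rfl hne
    | @cons _ v _ hadj _ => exact ⟨v.1, v.2, hadj⟩
  · rintro ⟨_, j, hj, hadj⟩
    refine ⟨⟨k, hk⟩, rfl, ⟨j, hj⟩, ?_, ?_⟩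
    · rw [SimpleGraph.ConnectedComponent.mem_supp_iff, SimpleGraph.ConnectedComponent.eq]
      exact SimpleGraph.Adj.reachable (G := G.induce {k | x k = true})
        (show G.Adj j k from hadj.symm)
    · intro h
      exact G.ne_of_adj hadj (congrArg Subtype.val h)

/-- The connected components of size larger than one. -/
abbrev BigC (G : SimpleGraph (Fin K)) (x : Fin K → Bool) : Type :=
  {c : (G.induce {k | x k = true}).ConnectedComponent // 1 < Nat.card c.supp}

lemma Z_act {G : SimpleGraph (Fin K)} {x : Fin K → Bool} {k : Fin K} (h : k ∈ Zset G x) :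
    x k = true := (Finset.mem_filter.1 h).2.1

/-- The big component of a colliding link. -/
def compOf {G : SimpleGraph (Fin K)} {x : Fin K → Bool} (k : Fin K) (h : k ∈ Zset G x) :
    BigC G x :=
  ⟨(G.induce {k | x k = true}).connectedComponentMk ⟨k, Z_act h⟩, (big_iff G x k (Z_act h)).2 h⟩

lemma compOf_surj {G : SimpleGraph (Fin K)} {x : Fin K → Bool} (c : BigC G x) :
    ∃ k, ∃ h : k ∈ Zset G x, compOf k h = c := by
  obtain ⟨c, hc⟩ := c
  induction c using SimpleGraph.ConnectedComponent.ind with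
  | h v =>
    obtain ⟨k, hk⟩ := v
    exact ⟨k, (big_iff G x k hk).1 hc, rfl⟩

/-- The possible (length, remaining time) pairs of a successful link. -/
noncomputable def DF (P : Fin K → ℕ → ℝ) (B : ℕ) (k : Fin K) : Finset (Σ _ : ℕ, ℕ) :=
  ((Finset.range (B + 1)).filter (fun b => 0 < P k b)).sigma (fun b => Finset.Icc 1 b)

lemma DF_sum (P : Fin K → ℕ → ℝ) (hPnn : ∀ k b, 0 ≤ P k b) (B : ℕ)
    (hB : ∀ k b, B < b → P k b = 0) (k : Fin K) :
    ∑ d ∈ DF P B k, P k d.1 = ∑' b : ℕ, (b : ℝ) * P k b := by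
  rw [DF, Finset.sum_sigma, tsum_eq_sum (s := Finset.range (B + 1)), Finset.sum_filter]
  · refine Finset.sum_congr rfl fun b _ => ?_
    have := hPnn k b
    split_ifs with h
    · simp
    · rw [le_antisymm (not_lt.1 h) this]; simp
  · intro b hb
    rw [hB k b (by simpa using hb)]; simp

/-- Index type of valid states above `x`. -/
abbrev Idx (G : SimpleGraph (Fin K)) (P : Fin K → ℕ → ℝ) (γ B : ℕ) (x : Fin K → Bool) : Type :=
  (∀ k : {k // k ∈ Sset G x}, {d // d ∈ DF P B k.1}) × (BigC G x → Fin γ)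

/-- The state attached to an index. -/
noncomputable def mkState (G : SimpleGraph (Fin K)) (P : Fin K → ℕ → ℝ) (γ B : ℕ)
    (x : Fin K → Bool) (u : Idx G P γ B x) : CState K :=
  ⟨x, fun k => if h : k ∈ Sset G x then (u.1 ⟨k, h⟩).1.1 else if k ∈ Zset G x then γ else 0,
    fun k => if h : k ∈ Sset G x then (u.1 ⟨k, h⟩).1.2 else
      if h : k ∈ Zset G x then (u.2 (compOf k h)).1 + 1 else 0⟩

lemma mkState_valid (G : SimpleGraph (Fin K)) (P : Fin K → ℕ → ℝ) (γ B : ℕ)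
    (x : Fin K → Bool) (u : Idx G P γ B x) : ValidState G P γ (mkState G P γ B x u) := by
  have hD : ∀ k : {k // k ∈ Sset G x}, 0 < P k.1 (u.1 k).1.1 ∧ 1 ≤ (u.1 k).1.2 ∧
      (u.1 k).1.2 ≤ (u.1 k).1.1 := by
    intro k
    have := (u.1 k).2
    simp only [DF, Finset.mem_sigma, Finset.mem_filter, Finset.mem_Icc] at this
    exact ⟨this.1.2, this.2⟩
  refine ⟨?_, ?_, ?_, ?_, ?_⟩
  · intro k hk
    have hk : x k = false := hk
    have h1 : k ∉ Sset G x := by rw [S_iff]; simp [hk]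
    have h2 : k ∉ Zset G x := fun h => by simp [Z_act h] at hk
    simp [mkState, h1, h2]
  · intro k hk
    have hk : x k = true := hk
    by_cases h1 : k ∈ Sset G x
    · simpa [mkState, h1] using (hD ⟨k, h1⟩).2
    · have h2 : k ∈ Zset G x := by
        by_contra h2; exact h1 ((S_iff G x k).2 ⟨hk, h2⟩)
      simp only [mkState, h1, h2, dif_neg, dif_pos, if_pos, not_false_eq_true]
      have := (u.2 (compOf k h2)).2
      omega
  · intro k hk
    have h1 : k ∈ Sset G x := hk
    simpa [mkState, h1] using (hD ⟨k, h1⟩).1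
  · intro k hk
    have h2 : k ∈ Zset G x := hk
    have h1 : k ∉ Sset G x := fun h => ((S_iff G x k).1 h).2 h2
    simp [mkState, h1, h2]
  · intro k hk j hj ak aj hr
    have hk2 : k ∈ Zset G x := hk
    have hk1 : k ∉ Sset G x := fun h => ((S_iff G x k).1 h).2 hk2
    have hj2 : j ∈ Zset G x := hj
    have hj1 : j ∉ Sset G x := fun h => ((S_iff G x j).1 h).2 hj2
    have : compOf k hk2 = compOf j hj2 :=
      Subtype.ext (SimpleGraph.ConnectedComponent.eq.2 hr)
    simp [mkState, hk1, hk2, hj1, hj2, this]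

lemma mkState_bij (G : SimpleGraph (Fin K)) (P : Fin K → ℕ → ℝ) (γ B : ℕ)
    (hB : ∀ k b, B < b → P k b = 0) (x : Fin K → Bool) :
    Function.Bijective (fun u : Idx G P γ B x =>
      (⟨mkState G P γ B x u, mkState_valid G P γ B x u, rfl⟩ :
        {w : CState K // ValidState G P γ w ∧ w.x = x})) := by
  constructor
  · intro u v huv
    have huv : mkState G P γ B x u = mkState G P γ B x v := congrArg Subtype.val huv
    have hb := fun k => congrFun (congrArg CState.b huv) k
    have ha := fun k => congrFun (congrArg CState.a huv) k
    refine Prod.ext ?_ ?_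
    · funext ⟨k, hk⟩
      have hb := hb k
      have ha := ha k
      simp only [mkState, hk, dif_pos] at hb ha
      exact Subtype.ext (Sigma.ext hb (heq_of_eq ha))
    · funext c
      obtain ⟨k, hk2, rfl⟩ := compOf_surj c
      have hk1 : k ∉ Sset G x := fun h => ((S_iff G x k).1 h).2 hk2
      have ha := ha k
      simp only [mkState, hk1, hk2, dif_pos, dif_neg, not_false_eq_true] at ha
      exact Fin.ext (by omega)
  · rintro ⟨⟨x', b, a⟩, ⟨h1, h2, h3, h4, h5⟩, hx⟩
    obtain rfl : x' = x := hx
    dsimp only at h1 h2 h3 h4 h5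
    choose r hr hrc using fun c : BigC G x' => compOf_surj c
    have hra : ∀ k (hk : k ∈ Zset G x'), a (r (compOf k hk)) = a k := by
      intro k hk
      refine h5 _ (hr _) _ hk (Z_act (hr _)) (Z_act hk) ?_
      have := congrArg Subtype.val (hrc (compOf k hk))
      exact SimpleGraph.ConnectedComponent.eq.1 this
    have hlt : ∀ k ∈ Zset G x', a k - 1 < γ ∧ 1 ≤ a k := by
      intro k hk
      have := h2 k (Z_act hk)
      have := h4 k hk
      omega
    refine ⟨⟨fun k => ⟨⟨b k.1, a k.1⟩, ?_⟩, fun c => ⟨a (r c) - 1, (hlt _ (hr c)).1⟩⟩, ?_⟩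
    · have hP := h3 _ k.2
      have hle : b k.1 ≤ B := by
        by_contra h
        rw [hB _ _ (not_le.1 h)] at hP
        exact lt_irrefl _ hP
      have := h2 k.1 ((S_iff _ _ _).1 k.2).1
      simp only [DF, Finset.mem_sigma, Finset.mem_filter, Finset.mem_Icc, Finset.mem_range]
      exact ⟨⟨by omega, hP⟩, this⟩
    · refine Subtype.ext ?_
      simp only [mkState, CState.mk.injEq, true_and]
      constructor
      · funext k
        split_ifs with hs hz
        · rfl
        · exact (h4 k hz).symm
        · have : x' k = false := by
            by_contra h; exact hs ((S_iff _ _ _).2 ⟨by simpa using h, hz⟩)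
          exact (h1 k this).1.symm
      · funext k
        split_ifs with hs hz
        · rfl
        · rw [hra k hz]; have := (hlt k hz).2; omega
        · have : x' k = false := by
            by_contra h; exact hs ((S_iff _ _ _).2 ⟨by simpa using h, hz⟩)
          exact (h1 k this).2.symm

lemma pi0_mk (G : SimpleGraph (Fin K)) (P : Fin K → ℕ → ℝ) (p : Fin K → ℝ) (γ B : ℕ)
    (x : Fin K → Bool) (u : Idx G P γ B x) :
    pi0 G P p (mkState G P γ B x u) =
      (∏ k : {k // k ∈ Sset G x}, P k.1 (u.1 k).1.1) * ∏ i, (if x i then p i else 1 - p i) := by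
  have e : ∏ k : {k // k ∈ Sset G x}, P k.1 (u.1 k).1.1 =
      ∏ k ∈ Sset G x, P k ((mkState G P γ B x u).b k) := by
    rw [← Finset.prod_coe_sort (Sset G x)]
    refine Finset.prod_congr rfl fun k _ => ?_
    simp [mkState]
  rw [e]
  have e2 : ∏ k ∈ Sset G x, P k ((mkState G P γ B x u).b k) =
      ∏ k, if k ∈ Sset G x then P k ((mkState G P γ B x u).b k) else 1 := by
    simp
  rw [e2, ← Finset.prod_mul_distrib, pi0, Finset.prod_filter, Finset.prod_filter,
    ← Finset.prod_mul_distrib]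
  refine Finset.prod_congr rfl fun k _ => ?_
  change (if x k = false then 1 - p k else 1) *
    (if x k = true then p k * fwt G P ((mkState G P γ B x u).b k) k x else 1) = _
  simp only [fwt, S_iff]
  by_cases hx : x k = true
  · by_cases hz : k ∈ Zset G x
    · simp [hx, hz]
    · simp [hx, hz, mul_comm]
  · simp [hx]

/-- the sum of the unnormalized weights over valid states with on-off
state `x` equals `γ^{h(x)} · ∏_{k ∈ S(x)} T_k · ∏ᵢ pᵢ^{xᵢ} qᵢ^{1-xᵢ}`; consequently the
probability of the on-off state `x` under `π = π₀ / E` is that quantity divided by `E`. -/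
theorem stmt0
    (K : ℕ) (hK : 1 ≤ K) (G : SimpleGraph (Fin K))
    (p : Fin K → ℝ) (hp : ∀ i, p i ∈ Set.Ioo (0 : ℝ) 1)
    (γ : ℕ) (hγ : 1 ≤ γ)
    (P : Fin K → ℕ → ℝ) (hP0 : ∀ k, P k 0 = 0) (hPnn : ∀ k b, 0 ≤ P k b)
    (hPsum : ∀ k, ∑' b : ℕ, P k b = 1)
    (hPfin : ∃ bmax : ℕ, 0 < bmax ∧ ∀ k b, bmax < b → P k b = 0)
    (x : Fin K → Bool) :
    (∑' w : {w : CState K // ValidState G P γ w ∧ w.x = x}, pi0 G P p w.1) =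
      (γ : ℝ) ^ hnum G x * (∏ k ∈ Sset G x, ∑' b : ℕ, (b : ℝ) * P k b) *
        ∏ i, (if x i then p i else 1 - p i) ∧
    (∑' w : {w : CState K // ValidState G P γ w ∧ w.x = x},
        pi0 G P p w.1 / (∑' w' : {w' : CState K // ValidState G P γ w'}, pi0 G P p w'.1)) =
      ((γ : ℝ) ^ hnum G x * (∏ k ∈ Sset G x, ∑' b : ℕ, (b : ℝ) * P k b) *
          ∏ i, (if x i then p i else 1 - p i)) /
        (∑' w' : {w' : CState K // ValidState G P γ w'}, pi0 G P p w'.1) := by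
  have key : (∑' w : {w : CState K // ValidState G P γ w ∧ w.x = x}, pi0 G P p w.1) =
      (γ : ℝ) ^ hnum G x * (∏ k ∈ Sset G x, ∑' b : ℕ, (b : ℝ) * P k b) *
        ∏ i, (if x i then p i else 1 - p i) := by
    obtain ⟨B, -, hB⟩ := hPfin
    rw [← (Equiv.ofBijective _ (mkState_bij G P γ B hB x)).tsum_eq, tsum_fintype]
    simp only [Equiv.ofBijective_apply, pi0_mk]
    rw [← Finset.sum_mul, Fintype.sum_prod_type]
    congr 1
    simp only [Finset.sum_const, Finset.card_univ, nsmul_eq_mul, Fintype.card_fun,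
      Fintype.card_fin]
    rw [← Finset.mul_sum, hnum, Nat.card_eq_fintype_card, Nat.cast_pow]
    congr 1
    have := Finset.prod_univ_sum (fun k : {k // k ∈ Sset G x} =>
      (Finset.univ : Finset {d // d ∈ DF P B k.1})) (fun k d => P k.1 d.1.1)
    rw [Fintype.piFinset_univ] at this
    rw [← this, ← Finset.prod_coe_sort (Sset G x)]
    refine Finset.prod_congr rfl fun k _ => ?_
    rw [← DF_sum P hPnn B hB k.1]
    exact Finset.sum_coe_sort (DF P B k.1) (fun d => P k.1 d.1)
  exact ⟨key, by rw [tsum_div_const, key]⟩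
end

section
/- For all valid states w and w′, the balance equation π₀(w)·Q(w, w′) = π₀(w′)·Q̃(w′, w) holds. -/
open scoped BigOperators Classical

variable {K : ℕ}

/-- The local factor of link `i` in state `w`. -/
noncomputable def locFactor (G : SimpleGraph (Fin K)) (P : Fin K → ℕ → ℝ) (p : Fin K → ℝ)
    (w : CState K) (i : Fin K) : ℝ :=
  if w.x i then p i * fwt G P (w.b i) i w.x else 1 - p i

theorem pi0_eq (G : SimpleGraph (Fin K)) (P : Fin K → ℕ → ℝ) (p : Fin K → ℝ) (w : CState K) :
    pi0 G P p w = (∏ i ∈ A2 G w, locFactor G P p w i) * ∏ i ∈ A1bar G w, locFactor G P p w i := by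
  rw [A2, Finset.prod_sdiff (Finset.subset_univ _)]
  unfold locFactor
  rw [Finset.prod_ite, pi0, mul_comm]
  simp

theorem pi0_eq2 (G : SimpleGraph (Fin K)) (P : Fin K → ℕ → ℝ) (p : Fin K → ℝ) (v w : CState K) :
    pi0 G P p w = (∏ i ∈ A2 G v, locFactor G P p w i) * ∏ i ∈ A1bar G v, locFactor G P p w i := by
  rw [pi0_eq, A2, A2, Finset.prod_sdiff (Finset.subset_univ _),
    Finset.prod_sdiff (Finset.subset_univ _)]

theorem locFactor_eq (G : SimpleGraph (Fin K)) (P : Fin K → ℕ → ℝ) (p : Fin K → ℝ) (γ : ℕ)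
    (w w' : CState K) (hw : ValidState G P γ w) (h : Admissible G γ w w')
    (k : Fin K) (hk : k ∈ A1bar G w) : locFactor G P p w k = locFactor G P p w' k := by
  obtain ⟨h1, h2, -, -⟩ := h
  obtain ⟨-, -, -, -, h5⟩ := hw
  unfold locFactor
  rw [h1 k hk]
  cases hx : w.x k with
  | false => simp
  | true =>
    have hA : k ∈ A1 w := by
      simp only [A1bar, Finset.mem_union, Finset.mem_filter] at hk
      rcases hk with hk | hk
      · exact hk
      · simp [hx] at hk
    have ha : 1 < w.a k := by simp [A1] at hA; exact hA.2
    have hZ : k ∈ Zset G w.x ↔ k ∈ Zset G w'.x := by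
      constructor
      · intro hz
        have hz0 := hz
        simp only [Zset, Finset.mem_filter, Finset.mem_univ, true_and] at hz
        obtain ⟨-, j, hj, hadj⟩ := hz
        have hzj : j ∈ Zset G w.x := by
          simp only [Zset, Finset.mem_filter, Finset.mem_univ, true_and]
          exact ⟨hj, k, hx, hadj.symm⟩
        have hr : (G.induce {i | w.x i = true}).Reachable ⟨k, hx⟩ ⟨j, hj⟩ :=
          SimpleGraph.Adj.reachable (by simpa using hadj)
        have hEq := h5 k hz0 j hzj hx hj hr
        have hjA : j ∈ A1bar G w := by
          simp only [A1bar, Finset.mem_union]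
          left
          simp only [A1, Finset.mem_filter, Finset.mem_univ, true_and]
          exact ⟨hj, by omega⟩
        simp only [Zset, Finset.mem_filter, Finset.mem_univ, true_and]
        exact ⟨(h1 k hk).trans hx, j, (h1 j hjA).trans hj, hadj⟩
      · intro hz
        simp only [Zset, Finset.mem_filter, Finset.mem_univ, true_and] at hz ⊢
        obtain ⟨-, j, hj, hadj⟩ := hz
        refine ⟨hx, j, ?_, hadj⟩
        by_contra hne
        have hf : w.x j = false := by simpa using hne
        have hjA : j ∈ A1bar G w := by
          simp only [A1bar, Finset.mem_union, Finset.mem_filter, Finset.mem_univ, true_and]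
          exact Or.inr ⟨hf, k, hA, hadj.symm⟩
        have := h1 j hjA
        simp [hj, hf] at this
    simp only [fwt, hZ, (h2 k hk hx).1]

/-- the balance equation `π₀(w)·Q(w,w') = π₀(w')·Q̃(w',w)` holds for all
valid states `w, w'`. -/
theorem stmt2
    (K : ℕ) (hK : 1 ≤ K) (G : SimpleGraph (Fin K))
    (p : Fin K → ℝ) (hp : ∀ i, p i ∈ Set.Ioo (0 : ℝ) 1)
    (γ : ℕ) (hγ : 1 ≤ γ)
    (P : Fin K → ℕ → ℝ) (hP0 : ∀ k, P k 0 = 0) (hPnn : ∀ k b, 0 ≤ P k b)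
    (hPsum : ∀ k, ∑' b : ℕ, P k b = 1)
    (hPfin : ∃ bmax : ℕ, 0 < bmax ∧ ∀ k b, bmax < b → P k b = 0)
    (w w' : CState K) (hw : ValidState G P γ w) (hw' : ValidState G P γ w') :
    pi0 G P p w * Qmat G P p γ w w' = pi0 G P p w' * Qtil G P p γ w' w := by
  unfold Qmat Qtil
  by_cases h : Admissible G γ w w'
  · rw [if_pos h, if_pos h, pi0_eq2 G P p w w, pi0_eq2 G P p w w',
      Finset.prod_congr rfl (fun k hk => locFactor_eq G P p γ w w' hw h k hk)]
    change _ * _ * (∏ i ∈ A2 G w, locFactor G P p w' i) = _ * (∏ i ∈ A2 G w, locFactor G P p w i)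
    ring
  · rw [if_neg h, if_neg h, mul_zero, mul_zero]
end

section
/- For all valid states w and w′: Q(w, w′) > 0 if and only if Q(g(w′), g(w)) > 0, where g is the reversal map (g maps valid states to valid states and satisfies g(g(w)) = w); moreover, whenever Q(w, w′) > 0, one has Q̃(w′, w) = Q(g(w′), g(w)). -/
open scoped BigOperators Classical

variable {K : ℕ}

theorem revState_x (w : CState K) : (revState w).x = w.x := rfl

theorem revState_b (w : CState K) : (revState w).b = w.b := rfl

theorem revState_a_of_active (w : CState K) (k : Fin K) (h : w.x k = true) :
    (revState w).a k = w.b k - w.a k + 1 := by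
  simp [revState, h]

theorem valid_rev (G : SimpleGraph (Fin K)) (P : Fin K → ℕ → ℝ) (γ : ℕ) (w : CState K)
    (hw : ValidState G P γ w) : ValidState G P γ (revState w) := by
  obtain ⟨h1, h2, h3, h4, h5⟩ := hw
  refine ⟨?_, ?_, h3, h4, ?_⟩
  · intro k hk
    have hk' : w.x k = false := hk
    exact ⟨(h1 k hk').1, by simp [revState, hk']⟩
  · intro k hk
    have hk' : w.x k = true := hk
    rw [revState_a_of_active w k hk', revState_b]
    have := h2 k hk'
    omega
  · intro k hk j hj hxk hxj hr
    have hxk' : w.x k = true := hxk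
    have hxj' : w.x j = true := hxj
    rw [revState_a_of_active w k hxk', revState_a_of_active w j hxj',
      h4 k hk, h4 j hj, h5 k hk j hj hxk' hxj' hr]

theorem rev_rev (G : SimpleGraph (Fin K)) (P : Fin K → ℕ → ℝ) (γ : ℕ) (w : CState K)
    (hw : ValidState G P γ w) : revState (revState w) = w := by
  obtain ⟨h1, h2, -⟩ := hw
  obtain ⟨x, b, a⟩ := w
  simp only [revState, CState.mk.injEq, true_and]
  funext k
  cases hx : x k with
  | false => simpa using (h1 k hx).2.symm
  | true =>
    have := h2 k hx
    simp only at this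
    simp
    omega

theorem mem_A1 (w : CState K) (k : Fin K) : k ∈ A1 w ↔ w.x k = true ∧ 1 < w.a k := by
  simp [A1]

theorem mem_A1bar (G : SimpleGraph (Fin K)) (w : CState K) (k : Fin K) :
    k ∈ A1bar G w ↔ k ∈ A1 w ∨ (w.x k = false ∧ ∃ j ∈ A1 w, G.Adj k j) := by
  simp [A1bar]

theorem mem_A2 (G : SimpleGraph (Fin K)) (w : CState K) (k : Fin K) :
    k ∈ A2 G w ↔ k ∉ A1bar G w := by
  simp [A2]

theorem A1_of_bar_active (G : SimpleGraph (Fin K)) (w : CState K) (k : Fin K)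
    (h : k ∈ A1bar G w) (hx : w.x k = true) : k ∈ A1 w := by
  rcases (mem_A1bar G w k).1 h with h | h
  · exact h
  · simp [hx] at h

theorem A1_rev_eq (G : SimpleGraph (Fin K)) (P : Fin K → ℕ → ℝ) (γ : ℕ) (w w' : CState K)
    (hw : ValidState G P γ w) (hw' : ValidState G P γ w') (h : Admissible G γ w w') :
    A1 (revState w') = A1 w := by
  obtain ⟨a1, a2, a3, a4⟩ := h
  ext k
  constructor
  · intro hk
    obtain ⟨hx, ha⟩ := (mem_A1 _ k).1 hk
    have hx' : w'.x k = true := hx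
    rw [revState_a_of_active w' k hx'] at ha
    have hb : k ∈ A1bar G w := by
      by_contra hn
      have := a3 k ((mem_A2 G w k).2 hn) hx'
      omega
    exact A1_of_bar_active G w k hb ((a1 k hb).symm.trans hx')
  · intro hk
    have hb : k ∈ A1bar G w := (mem_A1bar G w k).2 (Or.inl hk)
    obtain ⟨hx, ha⟩ := (mem_A1 _ k).1 hk
    have hx' : w'.x k = true := (a1 k hb).trans hx
    refine (mem_A1 _ k).2 ⟨hx', ?_⟩
    rw [revState_a_of_active w' k hx']
    have := a2 k hb hx
    have := hw.2.1 k hx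
    omega

theorem A1bar_rev_eq (G : SimpleGraph (Fin K)) (P : Fin K → ℕ → ℝ) (γ : ℕ) (w w' : CState K)
    (hw : ValidState G P γ w) (hw' : ValidState G P γ w') (h : Admissible G γ w w') :
    A1bar G (revState w') = A1bar G w := by
  have hA := A1_rev_eq G P γ w w' hw hw' h
  obtain ⟨a1, a2, a3, a4⟩ := h
  ext k
  rw [mem_A1bar, hA]
  constructor
  · rintro (hk | ⟨hx, j, hj, hadj⟩)
    · exact (mem_A1bar G w k).2 (Or.inl hk)
    · have hx' : w'.x k = false := hx
      cases hwx : w.x k with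
      | false => exact (mem_A1bar G w k).2 (Or.inr ⟨hwx, j, hj, hadj⟩)
      | true =>
        obtain ⟨hxj, haj⟩ := (mem_A1 w j).1 hj
        have hkZ : k ∈ Zset G w.x := by
          simp only [Zset, Finset.mem_filter, Finset.mem_univ, true_and]
          exact ⟨hwx, j, hxj, hadj⟩
        have hjZ : j ∈ Zset G w.x := by
          simp only [Zset, Finset.mem_filter, Finset.mem_univ, true_and]
          exact ⟨hxj, k, hwx, hadj.symm⟩
        have heq := hw.2.2.2.2 k hkZ j hjZ hwx hxj
          (SimpleGraph.Adj.reachable (by simpa using hadj))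
        exact (mem_A1bar G w k).2 (Or.inl ((mem_A1 w k).2 ⟨hwx, by omega⟩))
  · intro hk
    rcases (mem_A1bar G w k).1 hk with h | ⟨hx, hj⟩
    · exact Or.inl h
    · exact Or.inr ⟨(a1 k hk).trans hx, hj⟩

theorem A2_rev_eq (G : SimpleGraph (Fin K)) (P : Fin K → ℕ → ℝ) (γ : ℕ) (w w' : CState K)
    (hw : ValidState G P γ w) (hw' : ValidState G P γ w') (h : Admissible G γ w w') :
    A2 G (revState w') = A2 G w := by
  rw [A2, A2, A1bar_rev_eq G P γ w w' hw hw' h]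

theorem admissible_rev (G : SimpleGraph (Fin K)) (P : Fin K → ℕ → ℝ) (γ : ℕ) (w w' : CState K)
    (hw : ValidState G P γ w) (hw' : ValidState G P γ w') (h : Admissible G γ w w') :
    Admissible G γ (revState w') (revState w) := by
  have hB := A1bar_rev_eq G P γ w w' hw hw' h
  have hC := A2_rev_eq G P γ w w' hw hw' h
  obtain ⟨a1, a2, a3, a4⟩ := h
  refine ⟨?_, ?_, ?_, ?_⟩
  · intro k hk
    rw [hB] at hk
    exact (a1 k hk).symm
  · intro k hk hx
    rw [hB] at hk
    have hx' : w'.x k = true := hx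
    have hwx : w.x k = true := (a1 k hk).symm.trans hx'
    obtain ⟨e1, e2⟩ := a2 k hk hwx
    have h1 := ((mem_A1 w k).1 (A1_of_bar_active G w k hk hwx)).2
    have h2 := hw.2.1 k hwx
    rw [revState_a_of_active w k hwx, revState_a_of_active w' k hx', revState_b, revState_b]
    omega
  · intro k hk hx
    rw [hC, mem_A2] at hk
    have hwx : w.x k = true := hx
    have h2 := hw.2.1 k hwx
    have h3 : ¬ 1 < w.a k := fun h =>
      hk ((mem_A1bar G w k).2 (Or.inl ((mem_A1 w k).2 ⟨hwx, h⟩)))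
    rw [revState_a_of_active w k hwx, revState_b]
    omega
  · intro k _ hZ
    exact hw.2.2.2.1 k hZ

theorem Qmat_pos_iff (G : SimpleGraph (Fin K)) (P : Fin K → ℕ → ℝ) (p : Fin K → ℝ)
    (hp : ∀ i, p i ∈ Set.Ioo (0 : ℝ) 1) (γ : ℕ) (w w' : CState K)
    (hw' : ValidState G P γ w') :
    0 < Qmat G P p γ w w' ↔ Admissible G γ w w' := by
  unfold Qmat
  by_cases h : Admissible G γ w w'
  · rw [if_pos h]
    refine ⟨fun _ => h, fun _ => Finset.prod_pos ?_⟩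
    intro i _
    cases hx : w'.x i with
    | false => simpa using (hp i).2
    | true =>
      rw [if_pos rfl]
      refine mul_pos (hp i).1 ?_
      unfold fwt
      split_ifs with hZ
      · exact one_pos
      · apply hw'.2.2.1
        simp only [Zset, Sset, Finset.mem_filter, Finset.mem_univ, true_and] at hZ ⊢
        exact ⟨hx, fun j hj hadj => hZ ⟨hx, j, hj, hadj⟩⟩
  · simp [h]

/-- the reversal map `g` maps valid states to valid states and is an
involution; `Q(w,w') > 0 ↔ Q(g(w'),g(w)) > 0`; and whenever `Q(w,w') > 0`,
`Q̃(w',w) = Q(g(w'),g(w))`. -/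
theorem stmt3
    (K : ℕ) (hK : 1 ≤ K) (G : SimpleGraph (Fin K))
    (p : Fin K → ℝ) (hp : ∀ i, p i ∈ Set.Ioo (0 : ℝ) 1)
    (γ : ℕ) (hγ : 1 ≤ γ)
    (P : Fin K → ℕ → ℝ) (hP0 : ∀ k, P k 0 = 0) (hPnn : ∀ k b, 0 ≤ P k b)
    (hPsum : ∀ k, ∑' b : ℕ, P k b = 1)
    (hPfin : ∃ bmax : ℕ, 0 < bmax ∧ ∀ k b, bmax < b → P k b = 0)
    (w w' : CState K) (hw : ValidState G P γ w) (hw' : ValidState G P γ w') :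
    ValidState G P γ (revState w) ∧ revState (revState w) = w ∧
    (0 < Qmat G P p γ w w' ↔ 0 < Qmat G P p γ (revState w') (revState w)) ∧
    (0 < Qmat G P p γ w w' →
      Qtil G P p γ w' w = Qmat G P p γ (revState w') (revState w)) := by
  have hr := valid_rev G P γ w hw
  have hr' := valid_rev G P γ w' hw'
  refine ⟨hr, rev_rev G P γ w hw, ?_, ?_⟩
  · rw [Qmat_pos_iff G P p hp γ w w' hw', Qmat_pos_iff G P p hp γ _ _ hr]
    refine ⟨admissible_rev G P γ w w' hw hw', fun h => ?_⟩
    have h2 := admissible_rev G P γ _ _ hr' hr h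
    rwa [rev_rev G P γ w hw, rev_rev G P γ w' hw'] at h2
  · intro hpos
    have hA := (Qmat_pos_iff G P p hp γ w w' hw').1 hpos
    have hA' := admissible_rev G P γ w w' hw hw' hA
    rw [Qtil, Qmat, if_pos hA, if_pos hA', A2_rev_eq G P γ w w' hw hw' hA]
    rfl
end

section
/- For every fixed λ ∈ ℝ^K, the function r ↦ L(r; λ) is concave on ℝ^K; equivalently, the function r ↦ log E(r) is convex on ℝ^K. -/
open scoped BigOperators Classical

variable {K : ℕ}

/-- `g(x) = γ^{h(x)} ∏ᵢ pᵢ^{xᵢ} qᵢ^{1-xᵢ}`. -/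
noncomputable def gON (G : SimpleGraph (Fin K)) (p : Fin K → ℝ) (γ : ℕ)
    (x : Fin K → Bool) : ℝ :=
  (γ : ℝ) ^ hnum G x * ∏ i, (if x i then p i else 1 - p i)

/-- The normalizing constant `E(r)`. -/
noncomputable def Efun (G : SimpleGraph (Fin K)) (p : Fin K → ℝ) (γ : ℕ) (τ T₀ : ℝ)
    (r : Fin K → ℝ) : ℝ :=
  ∑ x : Fin K → Bool, gON G p γ x * ∏ k ∈ Sset G x, (τ + T₀ * Real.exp (r k))

/-- The stationary probability `p(x; r)` of the on-off state `x`. -/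
noncomputable def pON (G : SimpleGraph (Fin K)) (p : Fin K → ℝ) (γ : ℕ) (τ T₀ : ℝ)
    (x : Fin K → Bool) (r : Fin K → ℝ) : ℝ :=
  gON G p γ x * (∏ k ∈ Sset G x, (τ + T₀ * Real.exp (r k))) / Efun G p γ τ T₀ r

/-- The service rate `s_k(r)` of link `k`. -/
noncomputable def sRate (G : SimpleGraph (Fin K)) (p : Fin K → ℝ) (γ : ℕ) (τ T₀ : ℝ)
    (k : Fin K) (r : Fin K → ℝ) : ℝ :=
  T₀ * Real.exp (r k) / (τ + T₀ * Real.exp (r k)) *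
    ∑ x ∈ Finset.univ.filter (fun x : Fin K → Bool => k ∈ Sset G x), pON G p γ τ T₀ x r

/-- `L(r; λ) = Σ_k λ_k r_k − log E(r)`. -/
noncomputable def Lfun (G : SimpleGraph (Fin K)) (p : Fin K → ℝ) (γ : ℕ) (τ T₀ : ℝ)
    (r lam : Fin K → ℝ) : ℝ :=
  (∑ k, lam k * r k) - Real.log (Efun G p γ τ T₀ r)

/-- The indicator vectors of the independent sets of `G`. -/
def indVecs (G : SimpleGraph (Fin K)) : Set (Fin K → ℝ) :=
  {v | ∃ σ : Fin K → Bool, (∀ i j, σ i = true → σ j = true → ¬ G.Adj i j) ∧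
        v = fun i => if σ i then (1 : ℝ) else 0}

/-- `λ` is strictly feasible iff it lies in the interior of the convex hull of the
indicator vectors of the independent sets of `G`. -/
def strictlyFeasible (G : SimpleGraph (Fin K)) (lam : Fin K → ℝ) : Prop :=
  lam ∈ interior (convexHull ℝ (indVecs G))

/-- The finite set `𝒮` of detailed states `(x, z)`. -/
noncomputable def DS (G : SimpleGraph (Fin K)) : Finset ((Fin K → Bool) × (Fin K → Bool)) :=
  Finset.univ.filter (fun s => ∀ k, k ∉ Sset G s.1 → s.2 k = false)

/-- `g(x, z) = g(x) · (τ')^{|S(x)| − Σ_k z_k} · T₀^{Σ_k z_k}`. -/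
noncomputable def gDS (G : SimpleGraph (Fin K)) (p : Fin K → ℝ) (γ : ℕ) (τ T₀ : ℝ)
    (s : (Fin K → Bool) × (Fin K → Bool)) : ℝ :=
  gON G p γ s.1 *
    τ ^ ((Sset G s.1).card - (Finset.univ.filter (fun k => s.2 k = true)).card) *
    T₀ ^ (Finset.univ.filter (fun k => s.2 k = true)).card

/-- The stationary probability `p((x, z); r)` of the detailed state `(x, z)`. -/
noncomputable def pDS (G : SimpleGraph (Fin K)) (p : Fin K → ℝ) (γ : ℕ) (τ T₀ : ℝ)
    (s : (Fin K → Bool) × (Fin K → Bool)) (r : Fin K → ℝ) : ℝ :=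
  gDS G p γ τ T₀ s * Real.exp (∑ k, if s.2 k then r k else 0) / Efun G p γ τ T₀ r

lemma DS_nonempty (G : SimpleGraph (Fin K)) : (DS G).Nonempty :=
  ⟨⟨fun _ => false, fun _ => false⟩,
    Finset.mem_filter.mpr ⟨Finset.mem_univ _, fun _ _ => rfl⟩⟩

/-- `G* = max_{(x,z) ∈ 𝒮} |log g(x, z)|`. -/
noncomputable def Gstar (G : SimpleGraph (Fin K)) (p : Fin K → ℝ) (γ : ℕ) (τ T₀ : ℝ) : ℝ :=
  (DS G).sup' (DS_nonempty G) (fun s => |Real.log (gDS G p γ τ T₀ s)|)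

/-- Log-convexity in multiplicative form, for positive functions. -/
def LogCvx {n : ℕ} (f : (Fin n → ℝ) → ℝ) : Prop :=
  (∀ x, 0 < f x) ∧ ∀ (x y : Fin n → ℝ) (a b : ℝ), 0 < a → 0 < b → a + b = 1 →
    f (a • x + b • y) ≤ f x ^ a * f y ^ b

lemma LogCvx.const {n : ℕ} {c : ℝ} (hc : 0 < c) : LogCvx (fun _ : Fin n → ℝ => c) := by
  refine ⟨fun _ => hc, fun x y a b ha hb hab => ?_⟩
  rw [← Real.rpow_add hc, hab, Real.rpow_one]

lemma LogCvx.exp {n : ℕ} (k : Fin n) : LogCvx (fun r : Fin n → ℝ => Real.exp (r k)) := by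
  refine ⟨fun _ => Real.exp_pos _, fun x y a b ha hb hab => ?_⟩
  simp only [← Real.exp_mul, ← Real.exp_add, Pi.add_apply, Pi.smul_apply, smul_eq_mul]
  apply le_of_eq
  ring_nf

lemma LogCvx.mul {n : ℕ} {f g : (Fin n → ℝ) → ℝ} (hf : LogCvx f) (hg : LogCvx g) :
    LogCvx (fun r => f r * g r) := by
  refine ⟨fun x => mul_pos (hf.1 x) (hg.1 x), fun x y a b ha hb hab => ?_⟩
  have h1 := hf.2 x y a b ha hb hab
  have h2 := hg.2 x y a b ha hb hab
  have h3 := mul_le_mul h1 h2 (hg.1 _).le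
    (mul_nonneg (Real.rpow_nonneg (hf.1 x).le a) (Real.rpow_nonneg (hf.1 y).le b))
  simp only [Real.mul_rpow (hf.1 _).le (hg.1 _).le]
  refine h3.trans (le_of_eq (by ring))

/-- Two-term Hölder inequality. -/
lemma two_term_holder {s t u v a b : ℝ} (hs : 0 < s) (ht : 0 < t) (hu : 0 < u) (hv : 0 < v)
    (ha : 0 < a) (hb : 0 < b) (hab : a + b = 1) :
    s ^ a * t ^ b + u ^ a * v ^ b ≤ (s + u) ^ a * (t + v) ^ b := by
  have hS : 0 < s + u := by positivity
  have hT : 0 < t + v := by positivity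
  have h1 := Real.geom_mean_le_arith_mean2_weighted ha.le hb.le
    (div_pos hs hS).le (div_pos ht hT).le hab
  have h2 := Real.geom_mean_le_arith_mean2_weighted ha.le hb.le
    (div_pos hu hS).le (div_pos hv hT).le hab
  rw [Real.div_rpow hs.le hS.le, Real.div_rpow ht.le hT.le] at h1
  rw [Real.div_rpow hu.le hS.le, Real.div_rpow hv.le hT.le] at h2
  have hA : 0 < (s + u) ^ a := Real.rpow_pos_of_pos hS a
  have hB : 0 < (t + v) ^ b := Real.rpow_pos_of_pos hT b
  have e : a * (s / (s + u)) + b * (t / (t + v)) + (a * (u / (s + u)) + b * (v / (t + v))) = 1 := by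
    have e1 : s / (s + u) + u / (s + u) = 1 := by field_simp
    have e2 : t / (t + v) + v / (t + v) = 1 := by field_simp
    linear_combination a * e1 + b * e2 + hab
  have h3 := (add_le_add h1 h2).trans_eq e
  rw [div_mul_div_comm, div_mul_div_comm, ← add_div, div_le_one (mul_pos hA hB)] at h3
  exact h3

lemma LogCvx.add {n : ℕ} {f g : (Fin n → ℝ) → ℝ} (hf : LogCvx f) (hg : LogCvx g) :
    LogCvx (fun r => f r + g r) := by
  refine ⟨fun x => add_pos (hf.1 x) (hg.1 x), fun x y a b ha hb hab => ?_⟩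
  exact (add_le_add (hf.2 x y a b ha hb hab) (hg.2 x y a b ha hb hab)).trans
    (two_term_holder (hf.1 x) (hf.1 y) (hg.1 x) (hg.1 y) ha hb hab)

lemma LogCvx.prod {n : ℕ} {ι : Type*} (s : Finset ι) (f : ι → (Fin n → ℝ) → ℝ)
    (hf : ∀ i, LogCvx (f i)) : LogCvx (fun r => ∏ i ∈ s, f i r) := by
  induction s using Finset.cons_induction with
  | empty => simpa using LogCvx.const one_pos
  | cons i s hi ih => simpa only [Finset.prod_cons] using (hf i).mul ih

lemma LogCvx.sum {n : ℕ} {ι : Type*} (s : Finset ι) (hs : s.Nonempty)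
    (f : ι → (Fin n → ℝ) → ℝ)
    (hf : ∀ i, LogCvx (f i)) : LogCvx (fun r => ∑ i ∈ s, f i r) := by
  induction hs using Finset.Nonempty.cons_induction with
  | singleton i => simpa using hf i
  | cons i s hi hs ih => simpa only [Finset.sum_cons] using (hf i).add ih

lemma LogCvx.convexOn_log {n : ℕ} {f : (Fin n → ℝ) → ℝ} (hf : LogCvx f) :
    ConvexOn ℝ Set.univ (fun r => Real.log (f r)) := by
  rw [convexOn_iff_forall_pos]
  refine ⟨convex_univ, fun x _ y _ a b ha hb hab => ?_⟩
  have h := Real.log_le_log (hf.1 _) (hf.2 x y a b ha hb hab)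
  rwa [Real.log_mul (Real.rpow_pos_of_pos (hf.1 x) a).ne' (Real.rpow_pos_of_pos (hf.1 y) b).ne',
    Real.log_rpow (hf.1 x), Real.log_rpow (hf.1 y)] at h

lemma gON_pos {n : ℕ} (G : SimpleGraph (Fin n)) (p : Fin n → ℝ)
    (hp : ∀ i, p i ∈ Set.Ioo (0 : ℝ) 1) (γ : ℕ) (hγ : 1 ≤ γ) (x : Fin n → Bool) :
    0 < gON G p γ x := by
  unfold gON
  have h : (0 : ℝ) < γ := by exact_mod_cast hγ
  refine mul_pos (pow_pos h _) (Finset.prod_pos fun i _ => ?_)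
  have := (hp i).1
  have := (hp i).2
  split_ifs <;> linarith

lemma Efun_logCvx {n : ℕ} (G : SimpleGraph (Fin n)) (p : Fin n → ℝ)
    (hp : ∀ i, p i ∈ Set.Ioo (0 : ℝ) 1) (γ : ℕ) (hγ : 1 ≤ γ) (τ T₀ : ℝ) (hτ : 0 < τ)
    (hT₀ : 0 < T₀) : LogCvx (fun r => Efun G p γ τ T₀ r) := by
  unfold Efun
  refine LogCvx.sum _ Finset.univ_nonempty _ fun x => ?_
  exact (LogCvx.const (gON_pos G p hp γ hγ x)).mul
    (LogCvx.prod _ _ fun k => (LogCvx.const hτ).add ((LogCvx.const hT₀).mul (LogCvx.exp k)))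

/-- for every fixed `λ`, `r ↦ L(r;λ)` is concave on `ℝ^K`;
equivalently, `r ↦ log E(r)` is convex on `ℝ^K`. -/
theorem stmt5
    (K : ℕ) (hK : 1 ≤ K) (G : SimpleGraph (Fin K))
    (p : Fin K → ℝ) (hp : ∀ i, p i ∈ Set.Ioo (0 : ℝ) 1)
    (γ : ℕ) (hγ : 1 ≤ γ) (τ T₀ : ℝ) (hτ : 0 < τ) (hT₀ : 0 < T₀)
    (lam : Fin K → ℝ) :
    ConcaveOn ℝ Set.univ (fun r : Fin K → ℝ => Lfun G p γ τ T₀ r lam) ∧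
    ConvexOn ℝ Set.univ (fun r : Fin K → ℝ => Real.log (Efun G p γ τ T₀ r)) := by
  have h := (Efun_logCvx G p hp γ hγ τ T₀ hτ hT₀).convexOn_log
  refine ⟨?_, h⟩
  have hl : ConcaveOn ℝ Set.univ (fun r : Fin K → ℝ => ∑ k, lam k * r k) := by
    refine ⟨convex_univ, fun x _ y _ a b _ _ _ => le_of_eq ?_⟩
    simp only [smul_eq_mul, Finset.mul_sum, ← Finset.sum_add_distrib, Pi.add_apply, Pi.smul_apply]
    exact Finset.sum_congr rfl fun k _ => by ring
  exact hl.sub h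
end

section
/- Suppose λ ∈ ℝ^K is strictly feasible. Then there exists a unique r* ∈ ℝ^K such that s_k(r*) = λ_k for every link k; moreover, this r* is the unique maximizer of the function r ↦ L(r; λ) over ℝ^K. -/
open scoped BigOperators Classical

variable {K : ℕ}

/-- A critical point of a coercive exponential sum exists. -/
lemma aux_exists {ι : Type*} (I : Finset ι) (c : ι → ℝ) (a : ι → Fin K → ℝ)
    (hc : ∀ i ∈ I, 0 < c i) (ε : ℝ) (hε : 0 < ε)
    (H : ∀ d : Fin K → ℝ, ∃ i ∈ I, ε * ‖d‖ ≤ ∑ k, a i k * d k) :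
    ∃ r : Fin K → ℝ, ∀ k, ∑ i ∈ I, c i * Real.exp (∑ j, a i j * r j) * a i k = 0 := by
  have hne : I.Nonempty := by
    obtain ⟨i, hi, -⟩ := H 0
    exact ⟨i, hi⟩
  obtain ⟨i0, hi0, hmin⟩ := I.exists_min_image c hne
  set F : (Fin K → ℝ) → ℝ := fun r => ∑ i ∈ I, c i * Real.exp (∑ j, a i j * r j) with hF
  have hcont : Continuous F := by
    rw [hF]; fun_prop
  have hlow : ∀ r, c i0 * (ε * ‖r‖) ≤ F r := by
    intro r
    obtain ⟨i, hi, h⟩ := H r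
    have h1 : c i * Real.exp (∑ j, a i j * r j) ≤ F r :=
      Finset.single_le_sum (f := fun i => c i * Real.exp (∑ j, a i j * r j))
        (fun j hj => (mul_pos (hc j hj) (Real.exp_pos _)).le) hi
    have h2 : ε * ‖r‖ ≤ Real.exp (∑ j, a i j * r j) := by
      have := Real.add_one_le_exp (∑ j, a i j * r j)
      linarith
    have h3 : c i0 * (ε * ‖r‖) ≤ c i * Real.exp (∑ j, a i j * r j) :=
      mul_le_mul (hmin i hi) h2 (by positivity) (hc i hi).le
    linarith
  have hlim : Filter.Tendsto F (Filter.cocompact _) Filter.atTop := by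
    refine Filter.tendsto_atTop_mono hlow ?_
    exact ((tendsto_norm_cocompact_atTop).const_mul_atTop hε).const_mul_atTop (hc i0 hi0)
  obtain ⟨r, hr⟩ := hcont.exists_forall_le hlim
  refine ⟨r, fun k => ?_⟩
  have hder : HasDerivAt (fun t : ℝ => ∑ i ∈ I, c i * Real.exp (∑ j, a i j * r j + t * a i k))
      (∑ i ∈ I, c i * Real.exp (∑ j, a i j * r j) * a i k) 0 := by
    refine HasDerivAt.fun_sum fun i _ => ?_
    have h1 : HasDerivAt (fun t : ℝ => ∑ j, a i j * r j + t * a i k) (a i k) 0 := by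
      simpa using ((hasDerivAt_id (0 : ℝ)).mul_const (a i k)).const_add (∑ j, a i j * r j)
    have h2 := (h1.exp).const_mul (c i)
    simpa [mul_assoc] using h2
  refine IsLocalMin.hasDerivAt_eq_zero (f := fun t : ℝ => ∑ i ∈ I, c i * Real.exp (∑ j, a i j * r j + t * a i k)) ?_ hder
  refine Filter.Eventually.of_forall fun t => ?_
  have := hr (fun j => r j + t * (Pi.single k (1 : ℝ) : Fin K → ℝ) j)
  have e : ∀ i, ∑ j, a i j * (r j + t * (Pi.single k (1 : ℝ) : Fin K → ℝ) j) = ∑ j, a i j * r j + t * a i k := by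
    intro i
    simp only [mul_add, Finset.sum_add_distrib]
    congr 1
    simp [Pi.single_apply, mul_comm]
  simp only [hF, e] at this
  simpa using this

/-- A critical point is a strict global minimizer. -/
lemma aux_strict {ι : Type*} (I : Finset ι) (c : ι → ℝ) (a : ι → Fin K → ℝ)
    (hc : ∀ i ∈ I, 0 < c i) (ε : ℝ) (hε : 0 < ε)
    (H : ∀ d : Fin K → ℝ, ∃ i ∈ I, ε * ‖d‖ ≤ ∑ k, a i k * d k)
    (r : Fin K → ℝ) (hr : ∀ k, ∑ i ∈ I, c i * Real.exp (∑ j, a i j * r j) * a i k = 0)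
    (r' : Fin K → ℝ) (hne : r' ≠ r) :
    ∑ i ∈ I, c i * Real.exp (∑ j, a i j * r j) <
      ∑ i ∈ I, c i * Real.exp (∑ j, a i j * r' j) := by
  have hz : ∑ i ∈ I, c i * Real.exp (∑ j, a i j * r j) * (∑ k, a i k * (r' - r) k) = 0 := by
    simp only [Finset.mul_sum]
    rw [Finset.sum_comm]
    refine Finset.sum_eq_zero fun k _ => ?_
    have := hr k
    rw [← zero_mul ((r' - r) k), ← this, Finset.sum_mul]
    exact Finset.sum_congr rfl fun i _ => by ring
  have hsplit : ∀ i, ∑ j, a i j * r' j = ∑ j, a i j * r j + ∑ k, a i k * (r' - r) k := by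
    intro i
    rw [← Finset.sum_add_distrib]
    exact Finset.sum_congr rfl fun j _ => by simp; ring
  have key : ∑ i ∈ I, (c i * Real.exp (∑ j, a i j * r j) +
      c i * Real.exp (∑ j, a i j * r j) * (∑ k, a i k * (r' - r) k)) <
      ∑ i ∈ I, c i * Real.exp (∑ j, a i j * r' j) := by
    have hw : ∀ i ∈ I, 0 < c i * Real.exp (∑ j, a i j * r j) :=
      fun i hi => mul_pos (hc i hi) (Real.exp_pos _)
    refine Finset.sum_lt_sum (fun i hi => ?_) ?_
    · rw [hsplit, Real.exp_add]
      have := Real.add_one_le_exp (∑ k, a i k * (r' - r) k)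
      nlinarith [mul_le_mul_of_nonneg_left this (hw i hi).le]
    · obtain ⟨i, hi, h⟩ := H (r' - r)
      refine ⟨i, hi, ?_⟩
      have hpos : 0 < ‖r' - r‖ := norm_pos_iff.mpr (sub_ne_zero.mpr hne)
      have hu : ∑ k, a i k * (r' - r) k ≠ 0 := by
        have := mul_pos hε hpos
        linarith
      rw [hsplit, Real.exp_add]
      have := Real.add_one_lt_exp hu
      nlinarith [mul_lt_mul_of_pos_left this (hw i hi)]
  rw [Finset.sum_add_distrib, hz, add_zero] at key
  exact key

/-- Index set of detailed states. -/
noncomputable def auxI (G : SimpleGraph (Fin K)) : Finset (Σ _ : Fin K → Bool, Finset (Fin K)) :=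
  Finset.univ.sigma fun x => (Sset G x).powerset

/-- Coefficient of a detailed state. -/
noncomputable def auxC (G : SimpleGraph (Fin K)) (p : Fin K → ℝ) (γ : ℕ) (τ T₀ : ℝ)
    (s : Σ _ : Fin K → Bool, Finset (Fin K)) : ℝ :=
  gON G p γ s.1 * (T₀ ^ s.2.card * τ ^ (Sset G s.1 \ s.2).card)

/-- Indicator vector. -/
noncomputable def auxV (s : Σ _ : Fin K → Bool, Finset (Fin K)) (k : Fin K) : ℝ :=
  if k ∈ s.2 then 1 else 0

lemma auxC_pos (G : SimpleGraph (Fin K)) (p : Fin K → ℝ) (hp : ∀ i, p i ∈ Set.Ioo (0 : ℝ) 1)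
    (γ : ℕ) (hγ : 1 ≤ γ) (τ T₀ : ℝ) (hτ : 0 < τ) (hT₀ : 0 < T₀)
    (s : Σ _ : Fin K → Bool, Finset (Fin K)) : 0 < auxC G p γ τ T₀ s := by
  unfold auxC gON
  have h1 : (0 : ℝ) < γ := by exact_mod_cast hγ
  have h2 : 0 < ∏ i, (if s.1 i then p i else 1 - p i) := by
    refine Finset.prod_pos fun i _ => ?_
    have := hp i
    split_ifs
    · exact this.1
    · linarith [this.2]
  positivity

lemma auxV_dot (s : Σ _ : Fin K → Bool, Finset (Fin K)) (r : Fin K → ℝ) :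
    ∑ k, auxV s k * r k = ∑ k ∈ s.2, r k := by
  simp [auxV]

lemma aux_term (τ T₀ : ℝ) (S t : Finset (Fin K)) (r : Fin K → ℝ) :
    (∏ k ∈ t, T₀ * Real.exp (r k)) * ∏ _k ∈ S \ t, τ =
      T₀ ^ t.card * τ ^ (S \ t).card * Real.exp (∑ k ∈ t, r k) := by
  rw [Finset.prod_mul_distrib, Finset.prod_const, Finset.prod_const, Real.exp_sum]
  ring

lemma Efun_eq (G : SimpleGraph (Fin K)) (p : Fin K → ℝ) (γ : ℕ) (τ T₀ : ℝ) (r : Fin K → ℝ) :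
    Efun G p γ τ T₀ r =
      ∑ s ∈ auxI G, auxC G p γ τ T₀ s * Real.exp (∑ k, auxV s k * r k) := by
  unfold Efun auxI
  rw [Finset.sum_sigma]
  refine Finset.sum_congr rfl fun x _ => ?_
  have : ∏ k ∈ Sset G x, (τ + T₀ * Real.exp (r k)) =
      ∏ k ∈ Sset G x, (T₀ * Real.exp (r k) + τ) :=
    Finset.prod_congr rfl fun k _ => add_comm _ _
  rw [this, Finset.prod_add, Finset.mul_sum]
  refine Finset.sum_congr rfl fun t _ => ?_
  rw [aux_term, auxV_dot]
  simp only [auxC]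
  ring

lemma aux_marg (τ T₀ : ℝ) (hτ : 0 < τ) (hT₀ : 0 < T₀) (S : Finset (Fin K)) (k : Fin K)
    (hk : k ∈ S) (r : Fin K → ℝ) :
    T₀ * Real.exp (r k) / (τ + T₀ * Real.exp (r k)) *
      ∏ j ∈ S, (τ + T₀ * Real.exp (r j)) =
    ∑ t ∈ S.powerset, T₀ ^ t.card * τ ^ (S \ t).card * Real.exp (∑ k ∈ t, r k) *
      (if k ∈ t then 1 else 0) := by
  have h1 : T₀ * Real.exp (r k) / (τ + T₀ * Real.exp (r k)) *
      ∏ j ∈ S, (τ + T₀ * Real.exp (r j)) =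
      ∏ j ∈ S, (T₀ * Real.exp (r j) + if j = k then 0 else τ) := by
    rw [← Finset.mul_prod_erase _ _ hk, ← Finset.mul_prod_erase S
      (fun j => (T₀ * Real.exp (r j) + if j = k then 0 else τ)) hk]
    have : ∏ j ∈ S.erase k, (T₀ * Real.exp (r j) + if j = k then 0 else τ) =
        ∏ j ∈ S.erase k, (τ + T₀ * Real.exp (r j)) := by
      refine Finset.prod_congr rfl fun j hj => ?_
      rw [if_neg (Finset.ne_of_mem_erase hj), add_comm]
    rw [this, ← mul_assoc]
    have h0 : τ + T₀ * Real.exp (r k) ≠ 0 := by positivity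
    rw [div_mul_cancel₀ _ h0]
    simp
  rw [h1, Finset.prod_add]
  refine Finset.sum_congr rfl fun t _ => ?_
  rw [← aux_term]
  by_cases h : k ∈ t
  · rw [if_pos h, mul_one]
    congr 1
    refine Finset.prod_congr rfl fun j hj => ?_
    rw [if_neg]
    rintro rfl
    exact (Finset.mem_sdiff.mp hj).2 h
  · rw [if_neg h, mul_zero, Finset.prod_eq_zero (i := k) (Finset.mem_sdiff.mpr ⟨hk, h⟩) (by simp),
      mul_zero]

lemma sRate_eq (G : SimpleGraph (Fin K)) (p : Fin K → ℝ) (γ : ℕ) (τ T₀ : ℝ)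
    (hτ : 0 < τ) (hT₀ : 0 < T₀) (k : Fin K) (r : Fin K → ℝ) :
    sRate G p γ τ T₀ k r =
      (∑ s ∈ auxI G, auxC G p γ τ T₀ s * Real.exp (∑ k, auxV s k * r k) * auxV s k) /
        Efun G p γ τ T₀ r := by
  unfold sRate pON auxI
  rw [← Finset.sum_div, mul_div_assoc']
  congr 1
  rw [Finset.sum_sigma, Finset.sum_filter, Finset.mul_sum]
  refine Finset.sum_congr rfl fun x _ => ?_
  split_ifs with h
  · rw [mul_left_comm, aux_marg τ T₀ hτ hT₀ _ k h r, Finset.mul_sum]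
    refine Finset.sum_congr rfl fun t _ => ?_
    rw [auxV_dot]
    simp only [auxC, auxV]
    ring
  · rw [mul_zero]
    symm
    refine Finset.sum_eq_zero fun t ht => ?_
    have : k ∉ t := fun hk => h (Finset.mem_powerset.mp ht hk)
    simp [auxV, this]

lemma aux_coercive (G : SimpleGraph (Fin K)) (hK : 1 ≤ K) (lam : Fin K → ℝ)
    (hlam : strictlyFeasible G lam) :
    ∃ ε : ℝ, 0 < ε ∧ ∀ d : Fin K → ℝ, ∃ s ∈ auxI G,
      ε * ‖d‖ ≤ ∑ k, (auxV s k - lam k) * d k := by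
  unfold strictlyFeasible at hlam
  rw [mem_interior_iff_mem_nhds, Metric.mem_nhds_iff] at hlam
  obtain ⟨δ, hδ, hball⟩ := hlam
  refine ⟨δ / 2, by positivity, fun d => ?_⟩
  by_contra hcon
  push Not at hcon
  have hhull : convexHull ℝ (indVecs G) ⊆
      {v : Fin K → ℝ | ∑ k, v k * d k < δ / 2 * ‖d‖ + ∑ k, lam k * d k} := by
    refine convexHull_min ?_ ?_
    · rintro v ⟨σ, hσ, rfl⟩
      have hmem : (⟨σ, Finset.univ.filter fun k => σ k = true⟩ :
          Σ _ : Fin K → Bool, Finset (Fin K)) ∈ auxI G := by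
        simp only [auxI, Finset.mem_sigma, Finset.mem_univ, true_and, Finset.mem_powerset]
        intro k hk
        simp only [Finset.mem_filter, Finset.mem_univ, true_and] at hk
        simp only [Sset, Finset.mem_filter, Finset.mem_univ, true_and]
        exact ⟨hk, fun j hj => hσ k j hk hj⟩
      have := hcon _ hmem
      simp only [sub_mul, Finset.sum_sub_distrib] at this
      simp only [auxV, Finset.mem_filter, Finset.mem_univ, true_and] at this
      simp only [Set.mem_setOf_eq]
      linarith
    · refine convex_halfSpace_lt ?_ _
      constructor
      · intro x y
        simp [add_mul, Finset.sum_add_distrib]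
      · intro c x
        simp [Finset.mul_sum, mul_assoc]
  haveI : Nonempty (Fin K) := ⟨⟨0, hK⟩⟩
  obtain ⟨k, hk⟩ : ∃ k, ‖d‖ ≤ |d k| := by
    obtain ⟨k, hk⟩ := Finite.exists_max (fun k => |d k|)
    exact ⟨k, (pi_norm_le_iff_of_nonneg (abs_nonneg _)).mpr fun j => by
      simpa [Real.norm_eq_abs] using hk j⟩
  set e : ℝ := δ / 2 * SignType.sign (d k) with he
  have hemem : lam + Pi.single k e ∈ Metric.ball lam δ := by
    rw [Metric.mem_ball, dist_eq_norm, add_sub_cancel_left]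
    have h1 : ‖(Pi.single k e : Fin K → ℝ)‖ ≤ δ / 2 := by
      refine (pi_norm_le_iff_of_nonneg (by positivity)).mpr fun j => ?_
      have he' : |e| ≤ δ / 2 := by
        rw [he, abs_mul, abs_of_pos (by positivity : 0 < δ / 2)]
        have : |((SignType.sign (d k) : SignType) : ℝ)| ≤ 1 := by
          rcases SignType.sign (d k) <;> simp
        nlinarith
      by_cases hj : j = k
      · subst hj; simpa using he'
      · simp [Pi.single_apply, hj]; positivity
    linarith
  have h := hhull (hball hemem)
  simp only [Set.mem_setOf_eq, Pi.add_apply, add_mul, Finset.sum_add_distrib] at h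
  have h2 : ∑ j, (Pi.single k e : Fin K → ℝ) j * d j = e * d k := by
    simp [Pi.single_apply]
  have h3 : e * d k = δ / 2 * |d k| := by
    rw [he, mul_assoc, sign_mul_self]
  rw [h2, h3] at h
  nlinarith

/-- for strictly feasible `λ` there is a unique `r*` with
`s_k(r*) = λ_k` for all `k`; moreover `r*` is the unique maximizer of `r ↦ L(r;λ)`. -/
theorem stmt8
    (K : ℕ) (hK : 1 ≤ K) (G : SimpleGraph (Fin K))
    (p : Fin K → ℝ) (hp : ∀ i, p i ∈ Set.Ioo (0 : ℝ) 1)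
    (γ : ℕ) (hγ : 1 ≤ γ) (τ T₀ : ℝ) (hτ : 0 < τ) (hT₀ : 0 < T₀)
    (lam : Fin K → ℝ) (hlam : strictlyFeasible G lam) :
    ∃ rstar : Fin K → ℝ,
      (∀ k, sRate G p γ τ T₀ k rstar = lam k) ∧
      (∀ r : Fin K → ℝ, (∀ k, sRate G p γ τ T₀ k r = lam k) → r = rstar) ∧
      (∀ r : Fin K → ℝ, r ≠ rstar → Lfun G p γ τ T₀ r lam < Lfun G p γ τ T₀ rstar lam) := by
  obtain ⟨ε, hε, H⟩ := aux_coercive G hK lam hlam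
  have hc : ∀ s ∈ auxI G, 0 < auxC G p γ τ T₀ s :=
    fun s _ => auxC_pos G p hp γ hγ τ T₀ hτ hT₀ s
  have hI : (auxI G).Nonempty := by
    obtain ⟨s, hs, -⟩ := H 0
    exact ⟨s, hs⟩
  have hEpos : ∀ r, 0 < Efun G p γ τ T₀ r := by
    intro r
    rw [Efun_eq]
    exact Finset.sum_pos (fun s hs => mul_pos (hc s hs) (Real.exp_pos _)) hI
  have hexp : ∀ (r : Fin K → ℝ) (s : Σ _ : Fin K → Bool, Finset (Fin K)),
      Real.exp (∑ k, (auxV s k - lam k) * r k) =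
        Real.exp (∑ k, auxV s k * r k) * Real.exp (-∑ k, lam k * r k) := by
    intro r s
    rw [← Real.exp_add]
    congr 1
    simp only [sub_mul, Finset.sum_sub_distrib]
    ring
  have hF : ∀ r, ∑ s ∈ auxI G, auxC G p γ τ T₀ s * Real.exp (∑ k, (auxV s k - lam k) * r k) =
      Real.exp (-Lfun G p γ τ T₀ r lam) := by
    intro r
    have h1 : -Lfun G p γ τ T₀ r lam =
        Real.log (Efun G p γ τ T₀ r) + -∑ k, lam k * r k := by
      unfold Lfun; ring
    rw [h1, Real.exp_add, Real.exp_log (hEpos r), Efun_eq, Finset.sum_mul]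
    exact Finset.sum_congr rfl fun s _ => by rw [hexp]; ring
  have hcrit : ∀ r, (∀ k, sRate G p γ τ T₀ k r = lam k) ↔
      ∀ k, ∑ s ∈ auxI G, auxC G p γ τ T₀ s *
        Real.exp (∑ j, (auxV s j - lam j) * r j) * (auxV s k - lam k) = 0 := by
    intro r
    refine forall_congr' fun k => ?_
    have h1 : ∑ s ∈ auxI G, auxC G p γ τ T₀ s *
        Real.exp (∑ j, (auxV s j - lam j) * r j) * (auxV s k - lam k) =
        ((∑ s ∈ auxI G, auxC G p γ τ T₀ s * Real.exp (∑ k, auxV s k * r k) * auxV s k) -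
          lam k * Efun G p γ τ T₀ r) * Real.exp (-∑ k, lam k * r k) := by
      rw [Efun_eq, Finset.mul_sum, ← Finset.sum_sub_distrib, Finset.sum_mul]
      exact Finset.sum_congr rfl fun s _ => by rw [hexp]; ring
    rw [h1, sRate_eq G p γ τ T₀ hτ hT₀, div_eq_iff (hEpos r).ne', mul_eq_zero,
      or_iff_left (Real.exp_pos _).ne', sub_eq_zero]
  have hstrict : ∀ r r', (∀ k, sRate G p γ τ T₀ k r = lam k) → r' ≠ r →
      Lfun G p γ τ T₀ r' lam < Lfun G p γ τ T₀ r lam := by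
    intro r r' hr hne
    have := aux_strict (auxI G) (auxC G p γ τ T₀) (fun s k => auxV s k - lam k) hc ε hε H r
      ((hcrit r).mp hr) r' hne
    rw [hF, hF, Real.exp_lt_exp] at this
    linarith
  obtain ⟨r, hr⟩ := aux_exists (auxI G) (auxC G p γ τ T₀) (fun s k => auxV s k - lam k) hc ε hε H
  have hr' := (hcrit r).mpr hr
  refine ⟨r, hr', fun r' h' => ?_, fun r' hne => hstrict r r' hr' hne⟩
  by_contra hne
  exact lt_asymm (hstrict r r' hr' hne) (hstrict r' r h' (Ne.symm hne))
end

section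
/- The convex hull of the indicator vectors of the independent sets of G (including the empty set) equals the set { Σ_{(x,z) ∈ 𝒮} p̄(x, z)·z : p̄ is a probability distribution on 𝒮 }, i.e. the set of all mixtures of the payload vectors z over detailed states. -/
open scoped BigOperators Classical

variable {K : ℕ}

/-- the convex hull of the indicator vectors of the independent sets of `G`
equals the set of all mixtures of the payload vectors `z` over detailed states. -/
theorem stmt9 (K : ℕ) (hK : 1 ≤ K) (G : SimpleGraph (Fin K)) :
    convexHull ℝ (indVecs G) =
      {v : Fin K → ℝ | ∃ pb : ((Fin K → Bool) × (Fin K → Bool)) → ℝ,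
        (∀ s ∈ DS G, 0 ≤ pb s) ∧ (∑ s ∈ DS G, pb s) = 1 ∧
        v = fun k => ∑ s ∈ DS G, pb s * (if s.2 k then (1 : ℝ) else 0)} := by
  apply Set.Subset.antisymm
  · apply convexHull_min
    · rintro v ⟨σ, hσ, rfl⟩
      have hmem : ((σ, σ) : (Fin K → Bool) × (Fin K → Bool)) ∈ DS G := by
        refine Finset.mem_filter.mpr ⟨Finset.mem_univ _, fun k hk => ?_⟩
        by_contra hne
        have hk1 : σ k = true := by simpa using hne
        exact hk (Finset.mem_filter.mpr ⟨Finset.mem_univ _, hk1, fun j hj => hσ k j hk1 hj⟩)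
      refine ⟨fun s => if s = (σ, σ) then 1 else 0, fun s _ => ?_, ?_, ?_⟩
      · dsimp only
        split_ifs <;> norm_num
      · rw [Finset.sum_ite_eq' (DS G) (σ, σ) (fun _ => (1 : ℝ)), if_pos hmem]
      · funext k
        rw [Finset.sum_eq_single_of_mem _ hmem]
        · simp
        · intro s _ hs
          simp [hs]
    · rintro u ⟨p, hp0, hp1, rfl⟩ w ⟨q, hq0, hq1, rfl⟩ a b ha hb hab
      refine ⟨fun s => a * p s + b * q s, fun s hs => ?_, ?_, ?_⟩
      · exact add_nonneg (mul_nonneg ha (hp0 s hs)) (mul_nonneg hb (hq0 s hs))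
      · rw [Finset.sum_add_distrib, ← Finset.mul_sum, ← Finset.mul_sum, hp1, hq1]
        linarith
      · funext k
        simp only [Pi.add_apply, Pi.smul_apply, smul_eq_mul, Finset.mul_sum]
        rw [← Finset.sum_add_distrib]
        exact Finset.sum_congr rfl fun s _ => by ring
  · rintro v ⟨p, hp0, hp1, rfl⟩
    have key := (convex_convexHull ℝ (indVecs G)).sum_mem (t := DS G) (w := p)
      (z := fun s k => if s.2 k then (1 : ℝ) else 0) hp0 hp1 (by
        intro s hs
        apply subset_convexHull
        refine ⟨s.2, ?_, rfl⟩
        have h := (Finset.mem_filter.mp hs).2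
        have h2 : ∀ k, s.2 k = true → k ∈ Sset G s.1 := by
          intro k hk
          by_contra hn
          rw [h k hn] at hk
          exact absurd hk (by simp)
        intro i j hi hj
        exact (Finset.mem_filter.mp (h2 i hi)).2.2 j (Finset.mem_filter.mp (h2 j hj)).2.1)
    convert key using 1
    funext k
    simp only [Finset.sum_apply, Pi.smul_apply, smul_eq_mul]
end
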